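/- In the Case A setup (see context), assume additionally that there is no decreasing path (possibly consisting of a single vertex) from a vertex of 𝓥_e to the origin in U⁺, i.e. no path y_0,…,y_s with y_0 ∈ 𝓥_e, y_s = 0 and p ≥ U⁺_{y_0 y_1} > U⁺_{y_1 y_2} > … > U⁺_{y_{s−1} y_s}. Then no good configuration U′ with U′_f > p for all f ∈ 𝓔_e belongs to E_n(p). -/

import Mathlib

open MeasureTheory

namespace CDP

/-- Vertices of the hypercubic lattice `ℤ^d`. -/
abbrev Vertex (d : ℕ) := Fin d → ℤ

/-- Nearest-neighbour adjacency in `ℤ^d`. -/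
def adj {d : ℕ} (x y : Vertex d) : Prop := (∑ i, |x i - y i|) = 1

/-- `e` is a nearest-neighbour (non-oriented) edge of `ℤ^d`, i.e. an element of `𝓔`. -/
def IsNNEdge {d : ℕ} (e : Sym2 (Vertex d)) : Prop := ∃ x y, adj x y ∧ e = s(x, y)

/-- Configurations: labels attached to (unordered) pairs of vertices; only the labels of
nearest-neighbour edges (elements of `𝓔`) are ever relevant. -/
abbrev Config (d : ℕ) := Sym2 (Vertex d) → ℝ

/-- `ℓ^1` norm of a vertex. -/
def norm1 {d : ℕ} (x : Vertex d) : ℤ := ∑ i, |x i|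

/-- The set `Ω`: configurations with values in `[0,1]`, pairwise distinct coordinates on `𝓔`,
and no infinite walk along which the labels are strictly monotone. -/
def goodConfigs (d : ℕ) : Set (Config d) :=
  {U | (∀ e, IsNNEdge e → U e ∈ Set.Icc (0 : ℝ) 1) ∧
    (∀ e f, IsNNEdge e → IsNNEdge f → U e = U f → e = f) ∧
    ¬ ∃ w : ℕ → Vertex d, (∀ i, adj (w i) (w (i + 1))) ∧
      (StrictMono (fun i => U s(w i, w (i + 1))) ∨ StrictAnti (fun i => U s(w i, w (i + 1))))}

/-- A labelling `σ` of the edges by "ever opens" which is consistent with the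
constrained-degree dynamics driven by `U`: an edge (attempting to open at time `U e`)
opens iff at that moment both of its end-vertices have degree `< κ` among the
previously opened edges. -/
def Consistent {d : ℕ} (κ : ℕ) (U : Config d) (σ : Sym2 (Vertex d) → Prop) : Prop :=
  ∀ e, IsNNEdge e →
    (σ e ↔ ∀ v ∈ e,
      Set.ncard {f : Sym2 (Vertex d) | IsNNEdge f ∧ v ∈ f ∧ f ≠ e ∧ U f < U e ∧ σ f} < κ)

/-- `ω_p(U, e) = 1`, i.e. the edge `e` is `p`-open in the constrained-degree percolation
process with constraint `κ` driven by `U`. -/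
def openEdge {d : ℕ} (κ : ℕ) (U : Config d) (p : ℝ) (e : Sym2 (Vertex d)) : Prop :=
  IsNNEdge e ∧ U e ≤ p ∧ ∃ σ, Consistent κ U σ ∧ σ e

/-- `x 0, …, x k` is a path: consecutive vertices adjacent, all vertices distinct. -/
def IsPathOn {d : ℕ} (k : ℕ) (x : ℕ → Vertex d) : Prop :=
  (∀ i < k, adj (x i) (x (i + 1))) ∧ ∀ i ≤ k, ∀ j ≤ k, x i = x j → i = j

/-- The modified one-arm event `E_n(p)`: a path `x_0, …, x_k` with `‖x_0‖₁ = n`,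
`‖x_i‖₁ < n` for `1 ≤ i ≤ k`, `x_k = 0`, whose head consists of `p`-open edges and whose
tail is decreasing (values `≤ p`, strictly decreasing towards the origin). -/
def modifiedOneArm {d : ℕ} (κ n : ℕ) (p : ℝ) (U : Config d) : Prop :=
  ∃ (k : ℕ) (x : ℕ → Vertex d),
    IsPathOn k x ∧ norm1 (x 0) = (n : ℤ) ∧ (∀ i, 1 ≤ i → i ≤ k → norm1 (x i) < (n : ℤ)) ∧
    x k = 0 ∧
    ∃ l ≤ k,
      (∀ i < l, openEdge κ U p s(x i, x (i + 1))) ∧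
      (∀ i, l ≤ i → i < k → U s(x i, x (i + 1)) ≤ p) ∧
      (∀ i, l ≤ i → i + 1 < k → U s(x (i + 1), x (i + 2)) < U s(x i, x (i + 1)))

/-- `a` and `b` are connected by a `p`-open path. -/
def openConn {d : ℕ} (κ : ℕ) (U : Config d) (p : ℝ) (a b : Vertex d) : Prop :=
  ∃ (k : ℕ) (x : ℕ → Vertex d), IsPathOn k x ∧ x 0 = a ∧ x k = b ∧
    ∀ i < k, openEdge κ U p s(x i, x (i + 1))

/-- There is an infinite `p`-open path starting at the origin. -/
def zeroToInf {d : ℕ} (κ : ℕ) (U : Config d) (p : ℝ) : Prop :=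
  ∃ x : ℕ → Vertex d, x 0 = 0 ∧ (∀ i, adj (x i) (x (i + 1))) ∧ Function.Injective x ∧
    ∀ i, openEdge κ U p s(x i, x (i + 1))

/-- `P` is the law of i.i.d. `Uniform[0,1]` labels: a probability measure whose
finite-dimensional cylinder probabilities are products of uniform probabilities. -/
def IsProductUniform {d : ℕ} (P : Measure (Config d)) : Prop :=
  IsProbabilityMeasure P ∧
    ∀ (s : Finset (Sym2 (Vertex d))) (f : Sym2 (Vertex d) → Set ℝ),
      (∀ e ∈ s, MeasurableSet (f e)) →
      P {U | ∀ e ∈ s, U e ∈ f e} = ∏ e ∈ s, volume (f e ∩ Set.Icc 0 1)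

/-- The one-arm probability `θ_n(p)`. -/
noncomputable def theta {d : ℕ} (κ : ℕ) (P : Measure (Config d)) (n : ℕ) (p : ℝ) : ℝ :=
  (P {U | U ∈ goodConfigs d ∧ ∃ b, norm1 b = (n : ℤ) ∧ openConn κ U p 0 b}).toReal

/-- `θ(p) = ℙ(0 ↔ ∞)`. -/
noncomputable def thetaInf {d : ℕ} (κ : ℕ) (P : Measure (Config d)) (p : ℝ) : ℝ :=
  (P {U | U ∈ goodConfigs d ∧ zeroToInf κ U p}).toReal

/-- The critical point `p_c`. -/
noncomputable def pc {d : ℕ} (κ : ℕ) (P : Measure (Config d)) : ℝ :=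
  sSup {p : ℝ | p ∈ Set.Icc (0 : ℝ) 1 ∧ thetaInf κ P p = 0}

/-- The modified one-arm probability `τ_n(p)`. -/
noncomputable def tau {d : ℕ} (κ : ℕ) (P : Measure (Config d)) (n : ℕ) (p : ℝ) : ℝ :=
  (P {U | U ∈ goodConfigs d ∧ modifiedOneArm κ n p U}).toReal

/-- `e` is `p`-pivotal for `E_n(p)` at `U`. -/
def pPivotal {d : ℕ} (κ n : ℕ) (p : ℝ) (e : Sym2 (Vertex d)) (U : Config d) : Prop :=
  U ∈ goodConfigs d ∧ p < U e ∧ Function.update U e p ∈ goodConfigs d ∧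
    ¬ (modifiedOneArm κ n p U ↔ modifiedOneArm κ n p (Function.update U e p))

/-- `e` is `U`-pivotal for `E_n(p)` at `U`. -/
def uPivotal {d : ℕ} (κ n : ℕ) (p : ℝ) (e : Sym2 (Vertex d)) (U : Config d) : Prop :=
  U ∈ goodConfigs d ∧ ∃ U' ∈ goodConfigs d, (∀ f, f ≠ e → U' f = U f) ∧
    ¬ (modifiedOneArm κ n p U ↔ modifiedOneArm κ n p U')


/-- The edge set `𝓔_e` of the switching path of `e`: edges where `ω_p(U^{e+})` and
`ω_p(U^{e−})` differ. -/
def switchEdges {d : ℕ} (κ : ℕ) (U : Config d) (p : ℝ) (e : Sym2 (Vertex d)) :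
    Set (Sym2 (Vertex d)) :=
  {f | IsNNEdge f ∧
    ¬ (openEdge κ (Function.update U e 0) p f ↔ openEdge κ (Function.update U e 1) p f)}

/-- The vertex set `𝓥_e` of the switching path of `e`. -/
def switchVerts {d : ℕ} (κ : ℕ) (U : Config d) (p : ℝ) (e : Sym2 (Vertex d)) :
    Set (Vertex d) :=
  {v | ∃ f ∈ switchEdges κ U p e, v ∈ f}

/-- A *good* configuration (Case A): `U'_f > p` for every edge `f` meeting `𝓥_e` with
`ω⁺_f = 0`, and `U'_f = U_f` for every remaining edge `f ∈ 𝓔 \ 𝓔_e`. -/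
def GoodCfg {d : ℕ} (κ : ℕ) (U Uplus : Config d) (p : ℝ) (e : Sym2 (Vertex d))
    (U' : Config d) : Prop :=
  U' ∈ goodConfigs d ∧
    (∀ f, IsNNEdge f → (∃ v ∈ switchVerts κ U p e, v ∈ f) → ¬ openEdge κ Uplus p f →
      p < U' f) ∧
    (∀ f, IsNNEdge f → f ∉ switchEdges κ U p e →
      ¬ ((∃ v ∈ switchVerts κ U p e, v ∈ f) ∧ ¬ openEdge κ Uplus p f) → U' f = U f)

variable {d : ℕ}

lemma adj.symm {x y : Vertex d} (h : adj x y) : adj y x := by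
  simpa only [adj, abs_sub_comm] using h

lemma finite_edges_at (v : Vertex d) : {f : Sym2 (Vertex d) | IsNNEdge f ∧ v ∈ f}.Finite := by
  refine ((Set.finite_Icc (v - 1) (v + 1)).image fun y => s(v, y)).subset ?_
  have key : ∀ y : Vertex d, adj v y → y ∈ Set.Icc (v - 1) (v + 1) := by
    intro y h
    have hle : ∀ i, |v i - y i| ≤ 1 := fun i =>
      (Finset.single_le_sum (f := fun i => |v i - y i|) (fun j _ => abs_nonneg _)
        (Finset.mem_univ i)).trans_eq h
    constructor <;> intro i <;> have := abs_le.1 (hle i) <;> simp <;> omega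
  rintro f ⟨⟨x, y, hxy, rfl⟩, hv⟩
  rcases Sym2.mem_iff.1 hv with rfl | rfl
  · exact ⟨y, key y hxy, rfl⟩
  · exact ⟨x, key x hxy.symm, Sym2.eq_swap⟩

lemma exists_adj_of_mem {v : Vertex d} {f : Sym2 (Vertex d)} (hf : IsNNEdge f) (hv : v ∈ f) :
    ∃ w, adj v w ∧ f = s(v, w) := by
  obtain ⟨x, y, hxy, rfl⟩ := hf
  rcases Sym2.mem_iff.1 hv with rfl | rfl
  · exact ⟨y, hxy, rfl⟩
  · exact ⟨x, hxy.symm, Sym2.eq_swap⟩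

/-- Two nearest-neighbour edges share a vertex and the first has the smaller label. -/
def EdgeLT (U : Config d) (f e : Sym2 (Vertex d)) : Prop :=
  IsNNEdge f ∧ IsNNEdge e ∧ U f < U e ∧ ∃ v ∈ f, v ∈ e

/-- Since there are no infinite decreasing walks, the label order on touching edges is
well-founded: otherwise, following from each vertex the edge of minimal label among the
non-accessible edges yields such a walk. -/
lemma wellFounded_edgeLT {U : Config d} (hU : U ∈ goodConfigs d) : WellFounded (EdgeLT U) := by
  by_contra hwf
  have hbad : ∃ e, ¬ Acc (EdgeLT U) e := by
    by_contra! h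
    exact hwf ⟨h⟩
  have hpred : ∀ e, ¬ Acc (EdgeLT U) e → ∃ f, EdgeLT U f e ∧ ¬ Acc (EdgeLT U) f := by
    intro e he
    by_contra! h
    exact he ⟨e, h⟩
  let B : Vertex d → Set (Sym2 (Vertex d)) :=
    fun v => {f | (IsNNEdge f ∧ v ∈ f) ∧ ¬ Acc (EdgeLT U) f}
  have hstep : ∀ v, (B v).Nonempty → ∃ w, adj v w ∧ s(v, w) ∈ B v ∧
      (∀ g ∈ B v, U s(v, w) ≤ U g) ∧ ∃ g ∈ B w, U g < U s(v, w) := by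
    intro v hv
    obtain ⟨f, hf, hmin⟩ := Set.exists_min_image (B v) U
      ((finite_edges_at v).subset fun f hf => hf.1) hv
    obtain ⟨w, hvw, rfl⟩ := exists_adj_of_mem hf.1.1 hf.1.2
    refine ⟨w, hvw, hf, hmin, ?_⟩
    obtain ⟨g, ⟨hg, -, hlt, u, hug, hu⟩, hgb⟩ := hpred _ hf.2
    rcases Sym2.mem_iff.1 hu with rfl | rfl
    · exact absurd (hmin g ⟨⟨hg, hug⟩, hgb⟩) (not_le.2 hlt)
    · exact ⟨g, ⟨⟨hg, hug⟩, hgb⟩, hlt⟩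
  obtain ⟨e₀, he₀⟩ := hbad
  obtain ⟨f₀, ⟨hf₀, -, -, v₀, hv₀, -⟩, hf₀b⟩ := hpred e₀ he₀
  choose next hadj hmem hmin hdec using hstep
  let S := {v : Vertex d // (B v).Nonempty}
  let F : S → S := fun v => ⟨next v.1 v.2, (hdec v.1 v.2).imp fun _ h => h.1⟩
  let w : ℕ → S := fun i => F^[i] ⟨v₀, f₀, ⟨hf₀, hv₀⟩, hf₀b⟩
  have hw : ∀ i, w (i + 1) = F (w i) := fun i => Function.iterate_succ_apply' F i _
  have hwv : ∀ i, (w (i + 1)).1 = next (w i).1 (w i).2 := fun i => by rw [hw]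
  refine hU.2.2 ⟨fun i => (w i).1, fun i => ?_, Or.inr (strictAnti_nat_of_succ_lt fun i => ?_)⟩
  · simp only [hwv]
    exact hadj _ _
  · obtain ⟨g, hg, hlt⟩ := hdec (w i).1 (w i).2
    rw [← hwv] at hg hlt
    refine lt_of_le_of_lt ?_ hlt
    have := hmin (w (i + 1)).1 (w (i + 1)).2 g hg
    rwa [← hwv] at this

lemma exists_consistent (κ : ℕ) {U : Config d} (hU : U ∈ goodConfigs d) :
    ∃ σ, Consistent κ U σ := by
  have hwf := wellFounded_edgeLT hU
  let σ : Sym2 (Vertex d) → Prop := hwf.fix fun e ih =>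
    ∀ v ∈ e, Set.ncard {f | v ∈ f ∧ ∃ h : EdgeLT U f e, ih f h} < κ
  refine ⟨σ, fun e he => ?_⟩
  have hσ : σ e ↔ ∀ v ∈ e, Set.ncard {f | v ∈ f ∧ ∃ _ : EdgeLT U f e, σ f} < κ :=
    iff_of_eq (hwf.fix_eq _ e)
  rw [hσ]
  refine forall₂_congr fun v hv => ?_
  congr! 3
  ext f
  constructor
  · rintro ⟨hvf, h, hf⟩
    exact ⟨h.1, hvf, fun hfe => (hfe ▸ h.2.2.1).false, h.2.2.1, hf⟩
  · rintro ⟨hf, hvf, -, hlt, hσf⟩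
    exact ⟨hvf, ⟨hf, he, hlt, v, hvf, hv⟩, hσf⟩

/-- The edges at `v` that are open in `τ` with label smaller than that of `f`. -/
def earlierOpen (U : Config d) (τ : Sym2 (Vertex d) → Prop) (f : Sym2 (Vertex d))
    (v : Vertex d) : Set (Sym2 (Vertex d)) :=
  {g | v ∈ g ∧ U g < U f ∧ τ g}

/-- `τ` obeys the constrained-degree dynamics driven by `U` up to time `p`. -/
def IsOpenProc (κ : ℕ) (U : Config d) (p : ℝ) (τ : Sym2 (Vertex d) → Prop) : Prop :=
  ∀ f, τ f ↔ IsNNEdge f ∧ U f ≤ p ∧ ∀ v ∈ f, (earlierOpen U τ f v).ncard < κ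

namespace IsOpenProc

variable {κ : ℕ} {U : Config d} {p : ℝ} {τ τ' : Sym2 (Vertex d) → Prop}

lemma finite_earlierOpen (h : IsOpenProc κ U p τ) (f : Sym2 (Vertex d)) (v : Vertex d) :
    (earlierOpen U τ f v).Finite :=
  (finite_edges_at v).subset fun g hg => ⟨((h g).1 hg.2.2).1, hg.1⟩

lemma of_consistent {σ : Sym2 (Vertex d) → Prop} (hσ : Consistent κ U σ) :
    IsOpenProc κ U p fun f => IsNNEdge f ∧ U f ≤ p ∧ σ f := by
  refine fun f => and_congr_right fun hf => and_congr_right fun hfp => ?_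
  rw [hσ f hf]
  refine forall₂_congr fun v _ => ?_
  congr! 3
  ext g
  constructor
  · rintro ⟨hg, hvg, -, hlt, hσg⟩
    exact ⟨hvg, hlt, hg, hlt.le.trans hfp, hσg⟩
  · rintro ⟨hvg, hlt, hg, -, hσg⟩
    exact ⟨hg, hvg, fun hgf => (hgf ▸ hlt).false, hlt, hσg⟩

lemma unique (hU : U ∈ goodConfigs d) (h : IsOpenProc κ U p τ) (h' : IsOpenProc κ U p τ')
    (f : Sym2 (Vertex d)) : τ f ↔ τ' f := by
  induction f using (wellFounded_edgeLT hU).induction with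
  | _ f ih =>
    rw [h f, h' f]
    refine and_congr_right fun hf => and_congr_right fun _ => forall₂_congr fun v hv => ?_
    suffices earlierOpen U τ f v = earlierOpen U τ' f v by rw [this]
    ext g
    refine and_congr_right fun hvg => and_congr_right fun hlt => ?_
    by_cases hg : IsNNEdge g
    · exact ih g ⟨hg, hf, hlt, v, hvg, hv⟩
    · exact iff_of_false (fun hτ => hg ((h g).1 hτ).1) fun hτ => hg ((h' g).1 hτ).1

lemma openEdge (κ : ℕ) (p : ℝ) (hU : U ∈ goodConfigs d) :
    IsOpenProc κ U p (CDP.openEdge κ U p) := by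
  obtain ⟨σ, hσ⟩ := exists_consistent κ hU
  convert of_consistent (p := p) hσ using 1
  ext f
  refine and_congr_right fun hf => and_congr_right fun hfp =>
    ⟨fun ⟨σ', hσ', h⟩ => ?_, fun h => ⟨σ, hσ, h⟩⟩
  exact ((unique hU (of_consistent (p := p) hσ') (of_consistent (p := p) hσ) f).1
    ⟨hf, hfp, h⟩).2.2

lemma openEdge_iff (hU : U ∈ goodConfigs d) (h : IsOpenProc κ U p τ) (f : Sym2 (Vertex d)) :
    CDP.openEdge κ U p f ↔ τ f :=
  unique hU (openEdge κ p hU) h f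

/-- Delaying the label of an edge that does not open beyond `p` changes nothing. -/
lemma update_of_not (h : IsOpenProc κ U p τ) {e : Sym2 (Vertex d)} (he : ¬ τ e) {t : ℝ}
    (ht : p < t) : IsOpenProc κ (Function.update U e t) p τ := by
  intro f
  by_cases hfe : f = e
  · subst hfe
    exact iff_of_false he fun hf => by simpa [ht.not_ge] using hf.2.1
  · rw [h f, Function.update_of_ne hfe]
    refine and_congr_right fun _ => and_congr_right fun _ => forall₂_congr fun v _ => ?_
    suffices earlierOpen U τ f v = earlierOpen (Function.update U e t) τ f v by rw [this]
    ext g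
    by_cases hge : g = e
    · subst hge
      exact iff_of_false (fun hg => he hg.2.2) fun hg => he hg.2.2
    · simp [earlierOpen, hge, hfe]

/-- Moving the label of an edge that does open to the beginning changes nothing. -/
lemma update_of_open (h : IsOpenProc κ U p τ) (hκ : 0 < κ) (hp : 0 ≤ p)
    {e : Sym2 (Vertex d)} (he : τ e) (hpos : ∀ f, IsNNEdge f → f ≠ e → 0 < U f)
    (hne : ∀ f, IsNNEdge f → f ≠ e → U f ≠ U e) :
    IsOpenProc κ (Function.update U e 0) p τ := by
  obtain ⟨heNN, -, hecard⟩ := (h e).1 he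
  intro f
  by_cases hfe : f = e
  · subst hfe
    refine iff_of_true he ⟨heNN, by simpa using hp, fun v _ => ?_⟩
    suffices earlierOpen (Function.update U f 0) τ f v = ∅ by simpa [this] using hκ
    refine Set.eq_empty_of_forall_notMem fun g hg => ?_
    by_cases hgf : g = f
    · subst hgf
      exact hg.2.1.false
    · have hlt := hg.2.1
      rw [Function.update_of_ne hgf, Function.update_self] at hlt
      exact (hpos g ((h g).1 hg.2.2).1 hgf).not_gt hlt
  rw [Function.update_of_ne hfe]
  refine ⟨fun hf => ?_, fun ⟨hf, hfp, hcard⟩ => (h f).2 ⟨hf, hfp, fun v hv => ?_⟩⟩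
  · obtain ⟨hfNN, hfp, hcard⟩ := (h f).1 hf
    refine ⟨hfNN, hfp, fun v hv => ?_⟩
    have hins : earlierOpen (Function.update U e 0) τ f v ⊆ insert e (earlierOpen U τ f v) := by
      intro g hg
      by_cases hge : g = e
      · exact Or.inl hge
      · exact Or.inr (by simpa [earlierOpen, hge, hfe] using hg)
    by_cases hve : v ∈ e ∧ U f < U e
    · have hsub : insert f (earlierOpen U τ f v) ⊆ earlierOpen U τ e v :=
        Set.insert_subset ⟨hv, hve.2, hf⟩ fun g hg => ⟨hg.1, hg.2.1.trans hve.2, hg.2.2⟩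
      have hfin := h.finite_earlierOpen f v
      calc _ ≤ (insert e (earlierOpen U τ f v)).ncard := Set.ncard_le_ncard hins (hfin.insert e)
        _ ≤ (earlierOpen U τ f v).ncard + 1 := Set.ncard_insert_le e _
        _ = (insert f (earlierOpen U τ f v)).ncard :=
          (Set.ncard_insert_of_notMem (fun hmem => hmem.2.1.false) hfin).symm
        _ ≤ (earlierOpen U τ e v).ncard := Set.ncard_le_ncard hsub (h.finite_earlierOpen e v)
        _ < κ := hecard v hve.1
    · refine (Set.ncard_le_ncard (fun g hg => ?_) (h.finite_earlierOpen f v)).trans_lt (hcard v hv)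
      rcases hins hg with rfl | hg'
      · have hfg := (hne f hfNN hfe).lt_or_gt.resolve_left fun hlt => hve ⟨hg.1, hlt⟩
        exact ⟨hg.1, hfg, he⟩
      · exact hg'
  · refine (Set.ncard_le_ncard (fun g hg => ?_) ?_).trans_lt (hcard v hv)
    · refine ⟨hg.1, ?_, hg.2.2⟩
      rw [Function.update_of_ne hfe]
      by_cases hge : g = e
      · subst hge
        simpa using hpos f hf hfe
      · simpa [hge] using hg.2.1
    · exact (finite_edges_at v).subset fun g hg => ⟨((h g).1 hg.2.2).1, hg.1⟩

end IsOpenProc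

lemma update_mem_goodConfigs {U : Config d} (hU : U ∈ goodConfigs d) {e : Sym2 (Vertex d)}
    {t : ℝ} (ht : t ∈ Set.Icc (0 : ℝ) 1) (hne : ∀ f, IsNNEdge f → f ≠ e → U f ≠ t) :
    Function.update U e t ∈ goodConfigs d := by
  refine ⟨fun f hf => ?_, fun f g hf hg hfg => ?_, ?_⟩
  · by_cases hfe : f = e
    · simpa [hfe] using ht
    · simpa [hfe] using hU.1 f hf
  · by_cases hfe : f = e <;> by_cases hge : g = e
    · rw [hfe, hge]
    · subst hfe
      exact absurd (by simpa [hge] using hfg.symm) (hne g hg hge)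
    · subst hge
      exact absurd (by simpa [hfe] using hfg) (hne f hf hfe)
    · exact hU.2.1 f g hf hg (by simpa [hfe, hge] using hfg)
  · rintro ⟨w, hw, hmono⟩
    have hinj : Function.Injective fun i => Function.update U e t s(w i, w (i + 1)) :=
      hmono.elim StrictMono.injective StrictAnti.injective
    obtain ⟨N, hN⟩ : ∃ N, ∀ i, s(w (i + N), w (i + N + 1)) ≠ e := by
      by_cases hex : ∃ i, s(w i, w (i + 1)) = e
      · obtain ⟨i, hi⟩ := hex
        refine ⟨i + 1, fun j hj => ?_⟩
        have := @hinj (j + (i + 1)) i (by simp only [hi, hj])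
        omega
      · exact ⟨0, fun i hi => hex ⟨_, hi⟩⟩
    have hshift : ∀ i, Function.update U e t s(w (i + N), w (i + N + 1)) =
        U s(w (i + N), w (i + 1 + N)) := fun i => by
      rw [Function.update_of_ne (hN i), Nat.add_right_comm]
    refine hU.2.2 ⟨fun i => w (i + N), fun i => ?_, hmono.imp (fun h i j hij => ?_)
      fun h i j hij => ?_⟩
    · simpa only [Nat.add_right_comm] using hw (i + N)
    all_goals
      have := h (Nat.add_lt_add_right hij N)
      simpa only [hshift] using this

/-- A configuration agreeing with `U` off `e` has, off the switching path, the open edges of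
`U^{e−}`. -/
lemma openEdge_iff_of_notMem_switchEdges {κ : ℕ} {U V : Config d} {p : ℝ}
    {e : Sym2 (Vertex d)} (hκ : 0 < κ) (hp : p ∈ Set.Ico (0 : ℝ) 1) (hU : U ∈ goodConfigs d)
    (hU01 : ∀ f, IsNNEdge f → U f ∈ Set.Ioo (0 : ℝ) 1) (hV : V ∈ goodConfigs d)
    (he : IsNNEdge e) (hVU : ∀ f, f ≠ e → V f = U f) {f : Sym2 (Vertex d)}
    (hf : IsNNEdge f) (hfe : f ∉ switchEdges κ U p e) :
    openEdge κ V p f ↔ openEdge κ (Function.update U e 1) p f := by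
  have hupd : ∀ t, Function.update V e t = Function.update U e t := fun t => by
    ext g
    by_cases hge : g = e
    · simp [hge]
    · simp [hge, hVU g hge]
  have hsame : openEdge κ (Function.update U e 0) p f ↔
      openEdge κ (Function.update U e 1) p f := by
    by_contra hcon
    exact hfe ⟨hf, hcon⟩
  have hproc := IsOpenProc.openEdge κ p hV
  by_cases hopen : openEdge κ V p e
  · have h0 := hproc.update_of_open hκ hp.1 hopen
      (fun g hg hge => hVU g hge ▸ (hU01 g hg).1) fun g hg hge h => hge (hV.2.1 g e hg he h)
    rw [hupd] at h0
    rw [← hsame]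
    exact (h0.openEdge_iff (update_mem_goodConfigs hU (by simp)
      fun g hg _ => (hU01 g hg).1.ne') f).symm
  · have h1 := hproc.update_of_not hopen hp.2
    rw [hupd] at h1
    exact (h1.openEdge_iff (update_mem_goodConfigs hU (by simp)
      fun g hg _ => (hU01 g hg).2.ne) f).symm

lemma self_mem_switchEdges {κ : ℕ} {U : Config d} {p : ℝ} {e : Sym2 (Vertex d)}
    (hκ : 0 < κ) (hp : p ∈ Set.Ico (0 : ℝ) 1) (hU : U ∈ goodConfigs d)
    (hU01 : ∀ f, IsNNEdge f → U f ∈ Set.Ioo (0 : ℝ) 1) (he : IsNNEdge e) :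
    e ∈ switchEdges κ U p e := by
  have hgood : Function.update U e 0 ∈ goodConfigs d :=
    update_mem_goodConfigs hU (by simp) fun g hg _ => (hU01 g hg).1.ne'
  refine ⟨he, fun h => ?_⟩
  have h0 : openEdge κ (Function.update U e 0) p e := by
    refine (IsOpenProc.openEdge κ p hgood e).2 ⟨he, by simpa using hp.1, fun v _ => ?_⟩
    convert hκ
    rw [Set.ncard_eq_zero ((IsOpenProc.openEdge κ p hgood).finite_earlierOpen e v)]
    refine Set.eq_empty_of_forall_notMem fun g hg => ?_
    have hlt := hg.2.1
    rw [Function.update_self] at hlt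
    exact (hgood.1 g hg.2.2.1).1.not_gt hlt
  have h1 := (h.1 h0).2.1
  rw [Function.update_self] at h1
  exact hp.2.not_ge h1

/-- In a good configuration whose labels on the switching path exceed `p`, the open edges are
those of `U⁺` off the switching path. -/
lemma GoodCfg.openEdge_iff {κ : ℕ} {U Uplus U' : Config d} {p : ℝ} {e : Sym2 (Vertex d)}
    (hgood : GoodCfg κ U Uplus p e U') (hgtp : ∀ f ∈ switchEdges κ U p e, p < U' f)
    (hUp : Uplus ∈ goodConfigs d) (hU : ∀ f ∉ switchEdges κ U p e, Uplus f = U f)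
    (f : Sym2 (Vertex d)) :
    openEdge κ U' p f ↔ openEdge κ Uplus p f ∧ f ∉ switchEdges κ U p e := by
  have hproc := IsOpenProc.openEdge κ p hUp
  have heq : ∀ g, openEdge κ Uplus p g ∧ g ∉ switchEdges κ U p e → U' g = Uplus g :=
    fun g hg => (hgood.2.2 g hg.1.1 hg.2 fun h => h.2 hg.1).trans (hU g hg.2).symm
  suffices hproc' : IsOpenProc κ U' p
      (fun f => openEdge κ Uplus p f ∧ f ∉ switchEdges κ U p e) from
    hproc'.openEdge_iff hgood.1 f
  refine fun f => ⟨fun hf => ?_, fun ⟨hf, hfp, hcard⟩ => ?_⟩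
  · obtain ⟨hfNN, hfp, hcard⟩ := (hproc f).1 hf.1
    refine ⟨hfNN, (heq f hf).trans_le hfp, fun v hv => ?_⟩
    refine (Set.ncard_le_ncard (fun g hg => ?_) (hproc.finite_earlierOpen f v)).trans_lt
      (hcard v hv)
    refine ⟨hg.1, ?_, hg.2.2.1⟩
    have hlt := hg.2.1
    rwa [heq f hf, heq g hg.2.2] at hlt
  · have hfe : f ∉ switchEdges κ U p e := fun h => (hgtp f h).not_ge hfp
    refine ⟨?_, hfe⟩
    by_contra hcl
    have htouch : ¬ ∃ v ∈ switchVerts κ U p e, v ∈ f :=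
      fun h => (hgood.2.1 f hf h hcl).not_ge hfp
    have hUf : U' f = Uplus f :=
      (hgood.2.2 f hf hfe fun h => htouch h.1).trans (hU f hfe).symm
    refine hcl ((hproc f).2 ⟨hf, hUf ▸ hfp, fun v hv => ?_⟩)
    refine (Set.ncard_le_ncard (fun g hg => ?_)
      ((finite_edges_at v).subset fun g hg => ⟨hg.2.2.1.1, hg.1⟩)).trans_lt (hcard v hv)
    have hg' : openEdge κ Uplus p g ∧ g ∉ switchEdges κ U p e :=
      ⟨hg.2.2, fun h => htouch ⟨v, ⟨g, h, hg.1⟩, hv⟩⟩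
    refine ⟨hg.1, ?_, hg'⟩
    rw [hUf, heq g hg']
    exact hg.2.1

/-- **Claim 2 (Case A)**: if there is no decreasing path (possibly a single vertex) from
`𝓥_e` to the origin in `U⁺`, then no good configuration `U'` with `U'_f > p` for all
`f ∈ 𝓔_e` belongs to `E_n(p)`. -/
theorem good_config_does_not_occur (d κ n : ℕ) (hd : 2 ≤ d) (hκ₁ : 2 ≤ κ) (hκ₂ : κ ≤ 2 * d)
    (hn : 1 ≤ n) (p : ℝ) (hp : p ∈ Set.Ioo (0 : ℝ) 1)
    (U : Config d) (hU : U ∈ goodConfigs d)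
    (hU01 : ∀ f, IsNNEdge f → U f ∈ Set.Ioo (0 : ℝ) 1)
    (e : Sym2 (Vertex d)) (he : IsNNEdge e) (hpiv : uPivotal κ n p e U)
    (Uplus Uminus : Config d)
    (hUp : Uplus ∈ goodConfigs d) (hUpa : ∀ f, f ≠ e → Uplus f = U f)
    (hUpE : modifiedOneArm κ n p Uplus)
    (hUm : Uminus ∈ goodConfigs d) (hUma : ∀ f, f ≠ e → Uminus f = U f)
    (hUmE : ¬ modifiedOneArm κ n p Uminus)
    (hnodec : ¬ ∃ (s : ℕ) (y : ℕ → Vertex d), IsPathOn s y ∧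
      y 0 ∈ switchVerts κ U p e ∧ y s = 0 ∧
      (∀ i < s, Uplus s(y i, y (i + 1)) ≤ p) ∧
      (∀ i, i + 1 < s → Uplus s(y (i + 1), y (i + 2)) < Uplus s(y i, y (i + 1))))
    (U' : Config d) (hgood : GoodCfg κ U Uplus p e U')
    (hgtp : ∀ f ∈ switchEdges κ U p e, p < U' f) :
    ¬ modifiedOneArm κ n p U' := by
  have hκ : 0 < κ := by omega
  have hp' : p ∈ Set.Ico (0 : ℝ) 1 := ⟨hp.1.le, hp.2⟩
  have hoff : ∀ f ∉ switchEdges κ U p e, f ≠ e := by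
    rintro f hf rfl
    exact hf (self_mem_switchEdges hκ hp' hU hU01 he)
  have htail : ∀ f, IsNNEdge f → U' f ≤ p → U' f = Uminus f := by
    intro f hf hfp
    have hfe : f ∉ switchEdges κ U p e := fun h => (hgtp f h).not_ge hfp
    rw [hUma f (hoff f hfe)]
    exact hgood.2.2 f hf hfe fun h => (hgood.2.1 f hf h.1 h.2).not_ge hfp
  have hhead : ∀ f, openEdge κ U' p f → openEdge κ Uminus p f := by
    intro f hf
    obtain ⟨hfp, hfe⟩ :=
      (hgood.openEdge_iff hgtp hUp (fun g hg => hUpa g (hoff g hg)) f).1 hf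
    rw [openEdge_iff_of_notMem_switchEdges hκ hp' hU hU01 hUp he hUpa hf.1 hfe] at hfp
    exact (openEdge_iff_of_notMem_switchEdges hκ hp' hU hU01 hUm he hUma hf.1 hfe).2 hfp
  rintro ⟨k, x, hx, hx0, hxn, hxk, l, hlk, hopen, hle, hdecr⟩
  have hlab : ∀ i, l ≤ i → i < k → U' s(x i, x (i + 1)) = Uminus s(x i, x (i + 1)) :=
    fun i hi hik => htail _ ⟨_, _, hx.1 i hik, rfl⟩ (hle i hi hik)
  refine hUmE ⟨k, x, hx, hx0, hxn, hxk, l, hlk, fun i hi => hhead _ (hopen i hi),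
    fun i hi hik => hlab i hi hik ▸ hle i hi hik, fun i hi hik => ?_⟩
  rw [← hlab i hi (by omega), ← hlab (i + 1) (by omega) hik]
  exact hdecr i hi hik

end CDP
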